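/- arXiv:1201.2322 — 2 statements merged into one kernel-verified Lean document; each statement's English description precedes it below -/
import Mathlib

section
/- Let k ≥ 80 be an integer with k ≡ 2 (mod 4), let w = k − 2, and let a : ℕ → ℝ satisfy a(1) = 1 and |a(n)| ≤ d(n)·n^{(k−1)/2} for all n ≥ 1, where d(n) is the number of divisors of n. For real σ > (k+1)/2 set L(σ) = Σ_{n=1}^∞ a(n)·n^{−σ}, and define the polynomial q(z) = Σ_{m=0}^{⌊(w−6)/4⌋} (−1)^m · (2πz)^{2m+1}/(2m+1)! · L(w − 2m). Then the set {θ ∈ [0, 2π) : Im q(e^{iθ}) = 0} has at most 10 elements. -/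
open Real

theorem abs_sin_nat_mul_le_mul_abs_sin (n : ℕ) (θ : ℝ) : |sin (n * θ)| ≤ n * |sin θ| := by
  induction n with
  | zero => simp
  | succ n ih =>
    have h : sin ((n + 1 : ℕ) * θ) = sin (n * θ) * cos θ + cos (n * θ) * sin θ := by
      rw [← sin_add]; congr 1; push_cast; ring
    rw [h]
    calc _ ≤ |sin (n * θ)| * |cos θ| + |cos (n * θ)| * |sin θ| := by
          rw [← abs_mul, ← abs_mul]; exact abs_add_le _ _
      _ ≤ n * |sin θ| * 1 + 1 * |sin θ| := by
          gcongr
          · exact abs_cos_le_one _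
          · exact abs_cos_le_one _
      _ = _ := by push_cast; ring

theorem abs_sinh_sub_sinh_le {x y B : ℝ} (hx : |x| ≤ B) (hy : |y| ≤ B) :
    |sinh x - sinh y| ≤ cosh B * |x - y| := by
  have := (convex_Icc (-B) B).norm_image_sub_le_of_norm_deriv_le (f := sinh) (C := cosh B)
    (fun z _ => differentiable_sinh z) (fun z hz => ?_) (abs_le.mp hy) (abs_le.mp hx)
  · simpa using this
  · rw [Real.deriv_sinh, norm_eq_abs, abs_of_pos (cosh_pos z), cosh_le_cosh]
    exact (abs_le.mpr hz).trans (le_abs_self B)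

/-- Coefficients of `Im sin (2π e^{iθ})` as a sine series. -/
noncomputable def sinCoeff (m : ℕ) : ℝ := (-1) ^ m * (2 * π) ^ (2 * m + 1) / (2 * m + 1).factorial

theorem im_ofReal_mul_exp_pow (r θ : ℝ) (n : ℕ) :
    (((r : ℂ) * Complex.exp (θ * Complex.I)) ^ n).im = r ^ n * sin (n * θ) := by
  rw [mul_pow, ← Complex.exp_nat_mul, ← mul_assoc,
    show (n : ℂ) * (θ : ℂ) = ((n * θ : ℝ) : ℂ) by push_cast; rfl, ← Complex.ofReal_pow,
    Complex.im_ofReal_mul, Complex.exp_ofReal_mul_I_im]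

theorem im_sin_two_pi_mul_exp (θ : ℝ) :
    (Complex.sin (2 * (π : ℂ) * Complex.exp (θ * Complex.I))).im
      = cos (2 * π * cos θ) * sinh (2 * π * sin θ) := by
  have h : 2 * (π : ℂ) * Complex.exp (θ * Complex.I)
      = ((2 * π * cos θ : ℝ) : ℂ) + ((2 * π * sin θ : ℝ) : ℂ) * Complex.I := by
    rw [Complex.exp_mul_I]; push_cast; ring
  rw [h, Complex.sin_add_mul_I, ← Complex.ofReal_sin, ← Complex.ofReal_cos, ← Complex.ofReal_sinh,
    ← Complex.ofReal_cosh]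
  simp [-Complex.ofReal_sin, -Complex.ofReal_cos, -Complex.ofReal_sinh,
    -Complex.ofReal_cosh, -Complex.ofReal_mul]

theorem im_sin_term (θ c : ℝ) (m : ℕ) :
    ((-1) ^ m * (2 * (π : ℂ) * Complex.exp (θ * Complex.I)) ^ (2 * m + 1)
      / ((2 * m + 1).factorial : ℂ) * (c : ℂ)).im
      = sinCoeff m * c * sin ((2 * m + 1 : ℕ) * θ) := by
  rw [show (-1) ^ m * (2 * (π : ℂ) * Complex.exp (θ * Complex.I)) ^ (2 * m + 1)
      / ((2 * m + 1).factorial : ℂ) * (c : ℂ)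
      = (((-1) ^ m / (2 * m + 1).factorial * c : ℝ) : ℂ)
        * (((2 * π : ℝ) : ℂ) * Complex.exp (θ * Complex.I)) ^ (2 * m + 1) by push_cast; ring,
    Complex.im_ofReal_mul, im_ofReal_mul_exp_pow, sinCoeff]
  ring

theorem hasSum_im_sin (θ : ℝ) :
    HasSum (fun m : ℕ => sinCoeff m * sin ((2 * m + 1 : ℕ) * θ))
      (cos (2 * π * cos θ) * sinh (2 * π * sin θ)) := by
  rw [← im_sin_two_pi_mul_exp]
  refine (Complex.hasSum_im (Complex.hasSum_sin _)).congr_fun fun m => ?_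
  have := im_sin_term θ 1 m
  simpa using this.symm

theorem exp_four_pi_lt : exp (4 * π) < 450000 := by
  have h1 : exp (4 * π) ≤ exp 13 := exp_le_exp.mpr (by linarith [pi_lt_d2])
  have h2 : exp 13 = exp 1 ^ 13 := by rw [← exp_nat_mul]; norm_num
  have h3 : exp 1 ^ 13 ≤ (2.7182818286 : ℝ) ^ 13 := by gcongr; exact exp_one_lt_d9.le
  rw [h2] at h1
  refine (h1.trans h3).trans_lt (by norm_num)

theorem cosh_two_pi_lt : cosh (2 * π) < 1100 := by
  have h1 : exp (2 * π) ≤ exp 7 := exp_le_exp.mpr (by linarith [pi_lt_d2])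
  have h2 : exp 7 = exp 1 ^ 7 := by rw [← exp_nat_mul]; norm_num
  have h3 : exp 1 ^ 7 ≤ (2.7182818286 : ℝ) ^ 7 := by gcongr; exact exp_one_lt_d9.le
  have h4 : (2.7182818286 : ℝ) ^ 7 < 1100 := by norm_num
  have h5 : exp (-(2 * π)) ≤ exp (2 * π) := exp_le_exp.mpr (by linarith [pi_pos])
  rw [cosh_eq]; linarith

/-- The derivative majorant of the perturbation series is small. -/
theorem exists_hasSum_majorant_le {b : ℕ → ℝ} (hb : ∀ m, |b m| ≤ 2⁻¹ ^ 36 * 4 ^ m) :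
    ∃ K : ℝ, K ≤ 1 / 10000 ∧
      HasSum (fun m : ℕ => |sinCoeff m * b m| * (2 * m + 1 : ℕ)) K := by
  have hmaj : HasSum (fun m : ℕ => 2⁻¹ ^ 36 * (2 * π) * ((4 * π) ^ (2 * m) / (2 * m).factorial))
      (2⁻¹ ^ 36 * (2 * π) * cosh (4 * π)) := (hasSum_cosh _).mul_left _
  have hle : ∀ m : ℕ, |sinCoeff m * b m| * (2 * m + 1 : ℕ)
      ≤ 2⁻¹ ^ 36 * (2 * π) * ((4 * π) ^ (2 * m) / (2 * m).factorial) := fun m => by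
    have h1 : |sinCoeff m| = (2 * π) ^ (2 * m + 1) / (2 * m + 1).factorial := by
      rw [sinCoeff, abs_div, abs_mul, abs_pow, abs_pow, abs_neg, abs_one, one_pow, one_mul,
        Nat.abs_cast, abs_of_pos two_pi_pos]
    calc _ = (2 * π) ^ (2 * m + 1) / (2 * m + 1).factorial * |b m| * (2 * m + 1 : ℕ) := by
          rw [abs_mul, h1]
      _ ≤ (2 * π) ^ (2 * m + 1) / (2 * m + 1).factorial * (2⁻¹ ^ 36 * 4 ^ m) * (2 * m + 1 : ℕ) := by
          gcongr; exact hb m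
      _ = _ := by
          have h2 : ((2 * m).factorial : ℝ) ≠ 0 := by positivity
          have h3 : ((2 * m + 1 : ℕ) : ℝ) ≠ 0 := by positivity
          have h4 : (4 * π) ^ (2 * m) = (2 * π) ^ (2 * m) * 4 ^ m := by
            rw [pow_mul, pow_mul, ← mul_pow]; congr 1; ring
          rw [Nat.factorial_succ, Nat.cast_mul, h4]
          field_simp
          ring
  have hs := Summable.of_nonneg_of_le (fun m => by positivity) hle hmaj.summable
  refine ⟨_, ?_, hs.hasSum⟩
  refine (hasSum_le hle hs.hasSum hmaj).trans ?_
  have h5 : cosh (4 * π) < 450000 := by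
    have : exp (-(4 * π)) ≤ exp (4 * π) := exp_le_exp.mpr (by linarith [pi_pos])
    rw [cosh_eq]; linarith [exp_four_pi_lt]
  calc (2⁻¹ : ℝ) ^ 36 * (2 * π) * cosh (4 * π) ≤ 2⁻¹ ^ 36 * (2 * 3.15) * 450000 := by
        gcongr; exact pi_lt_d2.le
    _ ≤ _ := by norm_num

theorem abs_le_of_hasSum_sin {c : ℕ → ℝ} {K θ e : ℝ}
    (hK : HasSum (fun m : ℕ => |c m| * (2 * m + 1 : ℕ)) K)
    (he : HasSum (fun m : ℕ => c m * sin ((2 * m + 1 : ℕ) * θ)) e) : |e| ≤ K * |sin θ| := by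
  have := he.norm_le_of_bounded (hK.mul_right |sin θ|) fun m => ?_
  · simpa using this
  · rw [norm_mul, norm_eq_abs, norm_eq_abs, mul_assoc]
    gcongr
    exact abs_sin_nat_mul_le_mul_abs_sin _ _

theorem abs_sub_le_of_hasSum_sin {c : ℕ → ℝ} {K θ₁ θ₂ e₁ e₂ : ℝ}
    (hK : HasSum (fun m : ℕ => |c m| * (2 * m + 1 : ℕ)) K)
    (h₁ : HasSum (fun m : ℕ => c m * sin ((2 * m + 1 : ℕ) * θ₁)) e₁)
    (h₂ : HasSum (fun m : ℕ => c m * sin ((2 * m + 1 : ℕ) * θ₂)) e₂) :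
    |e₁ - e₂| ≤ K * |θ₁ - θ₂| := by
  have := (h₁.sub h₂).norm_le_of_bounded (hK.mul_right |θ₁ - θ₂|) fun m => ?_
  · simpa using this
  · rw [← mul_sub, norm_mul, norm_eq_abs, norm_eq_abs, mul_assoc]
    gcongr
    refine (abs_sin_sub_sin_le _ _).trans_eq ?_
    rw [← mul_sub, abs_mul, Nat.abs_cast]

theorem two_mul_abs_sub_le_abs_cos_sub {x y : ℝ} (hx : x ∈ Set.Icc (1 / 8) (3 / 8))
    (hy : y ∈ Set.Icc (1 / 8) (3 / 8)) :
    2 * |x - y| ≤ |cos (2 * π * x) - cos (2 * π * y)| := by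
  obtain ⟨hx1, hx2⟩ := hx
  obtain ⟨hy1, hy2⟩ := hy
  have hp := pi_pos
  have e1 : (2 * π * x + 2 * π * y) / 2 = π / 2 - π * (1 / 2 - x - y) := by ring
  have e2 : (2 * π * x - 2 * π * y) / 2 = π * (x - y) := by ring
  rw [cos_sub_cos, e1, e2, sin_pi_div_two_sub, abs_mul, abs_mul, abs_neg, abs_two]
  have h1 : 1 / 2 ≤ |cos (π * (1 / 2 - x - y))| := by
    refine le_trans ?_ (le_abs_self _)
    rw [← cos_abs]
    have : |1 / 2 - x - y| ≤ 1 / 4 := abs_le.mpr ⟨by linarith, by linarith⟩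
    refine cos_pi_div_three.symm.trans_le
      (cos_le_cos_of_nonneg_of_le_pi (abs_nonneg _) (by linarith) ?_)
    rw [abs_mul, abs_of_pos hp]; nlinarith
  have h2 : 2 * |x - y| ≤ |sin (π * (x - y))| := by
    have : |x - y| ≤ 1 / 4 := abs_le.mpr ⟨by linarith, by linarith⟩
    have hj := mul_abs_le_abs_sin (x := π * (x - y)) (by rw [abs_mul, abs_of_pos hp]; nlinarith)
    rw [abs_mul, abs_of_pos hp] at hj
    convert hj using 1
    field_simp
  nlinarith [abs_nonneg (x - y), abs_nonneg (sin (π * (x - y)))]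

theorem one_half_le_cos_two_pi_mul {x : ℝ} (hx : |x| ≤ 1 / 8) : 1 / 2 ≤ cos (2 * π * x) := by
  have hp := pi_pos
  rw [← cos_abs]
  refine cos_pi_div_three.symm.trans_le
    (cos_le_cos_of_nonneg_of_le_pi (abs_nonneg _) (by linarith) ?_)
  rw [abs_mul, abs_of_pos two_pi_pos]
  nlinarith

theorem cos_two_pi_mul_add_half (x : ℝ) : cos (2 * π * (x + 1 / 2)) = -cos (2 * π * x) := by
  rw [← cos_add_pi]; congr 1; ring

theorem abs_mem_of_abs_cos_two_pi_mul_lt {x : ℝ} (hx : |x| ≤ 1) (h : |cos (2 * π * x)| < 1 / 2) :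
    |x| ∈ Set.Icc (1 / 8) (3 / 8) ∨ |x| ∈ Set.Icc (5 / 8) (7 / 8) := by
  have hcos : |cos (2 * π * |x|)| < 1 / 2 := by
    rcases abs_choice x with hx' | hx' <;> rw [hx']
    · exact h
    · rwa [mul_neg, cos_neg]
  set t := |x|
  have ht : 0 ≤ t := abs_nonneg x
  have hlt := abs_lt.mp hcos
  have h1 : 1 / 8 < t := by
    by_contra! h'
    linarith [one_half_le_cos_two_pi_mul (x := t) (abs_le.mpr ⟨by linarith, h'⟩)]
  have h2 : t < 3 / 8 ∨ 5 / 8 < t := by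
    by_contra! h'
    have e := cos_two_pi_mul_add_half (t - 1 / 2)
    rw [sub_add_cancel] at e
    linarith [one_half_le_cos_two_pi_mul (x := t - 1 / 2)
      (abs_le.mpr ⟨by linarith [h'.1], by linarith [h'.2]⟩)]
  have h3 : t < 7 / 8 := by
    by_contra! h'
    have e : cos (2 * π * t) = cos (2 * π * (t - 1)) := by
      rw [← cos_add_two_pi (2 * π * (t - 1))]; congr 1; ring
    linarith [one_half_le_cos_two_pi_mul (x := t - 1)
      (abs_le.mpr ⟨by linarith, by linarith⟩)]
  rcases h2 with h2 | h2
  · exact .inl ⟨h1.le, h2.le⟩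
  · exact .inr ⟨h2.le, h3.le⟩

theorem two_fifths_le_sin {θ : ℝ} (hθ : θ ∈ Set.Ioo 0 π) (hc : |cos θ| ≤ 7 / 8) :
    2 / 5 ≤ sin θ := by
  have h1 := sin_pos_of_mem_Ioo hθ
  have h2 := sin_sq_add_cos_sq θ
  have h3 := sq_le_sq' (abs_le.mp hc).1 (abs_le.mp hc).2
  nlinarith

theorem two_fifths_mul_sub_le_cos_sub {θ₁ θ₂ : ℝ} (h₁ : θ₁ ∈ Set.Ioo 0 π) (h₂ : θ₂ ∈ Set.Ioo 0 π)
    (hc₁ : |cos θ₁| ≤ 7 / 8) (hc₂ : |cos θ₂| ≤ 7 / 8) (h : θ₁ < θ₂) :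
    2 / 5 * |θ₁ - θ₂| ≤ |cos θ₁ - cos θ₂| := by
  obtain ⟨ξ, ⟨hξ₁, hξ₂⟩, hξ⟩ := exists_hasDerivAt_eq_slope cos (fun t => -sin t) h
    continuous_cos.continuousOn (fun t _ => hasDerivAt_cos t)
  have hξπ : ξ ∈ Set.Ioo 0 π := ⟨h₁.1.trans hξ₁, hξ₂.trans h₂.2⟩
  have hcξ : |cos ξ| ≤ 7 / 8 := by
    have a1 := cos_lt_cos_of_nonneg_of_le_pi h₁.1.le hξπ.2.le hξ₁
    have a2 := cos_lt_cos_of_nonneg_of_le_pi hξπ.1.le h₂.2.le hξ₂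
    exact abs_le.mpr ⟨by linarith [(abs_le.mp hc₂).1], by linarith [(abs_le.mp hc₁).2]⟩
  have hs := two_fifths_le_sin hξπ hcξ
  have hne : 0 < θ₂ - θ₁ := sub_pos.mpr h
  rw [eq_div_iff hne.ne'] at hξ
  rw [abs_sub_comm, abs_of_pos hne]
  refine le_trans ?_ (le_abs_self _)
  nlinarith

section PerturbedSine

variable {e : ℝ → ℝ}

theorem abs_cos_le_of_perturbed_zero (he : ∀ θ, |e θ| ≤ 1 / 10000 * |sin θ|) {θ : ℝ}
    (hθ : θ ∈ Set.Ioo 0 π) (hz : cos (2 * π * cos θ) * sinh (2 * π * sin θ) + e θ = 0) :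
    |cos (2 * π * cos θ)| ≤ 1 / 10000 := by
  have hs := sin_pos_of_mem_Ioo hθ
  have h1 : sin θ ≤ sinh (2 * π * sin θ) := by
    refine le_trans ?_ (self_le_sinh_iff.mpr (by positivity))
    nlinarith [pi_gt_three]
  have h2 : |cos (2 * π * cos θ)| * sinh (2 * π * sin θ) ≤ 1 / 10000 * sin θ := by
    have h3 := he θ
    rw [eq_neg_of_add_eq_zero_right hz, abs_neg, abs_mul, abs_of_pos (hs.trans_le h1),
      abs_of_pos hs] at h3
    exact h3
  refine le_of_mul_le_mul_right ?_ hs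
  exact le_trans (by gcongr) h2

theorem perturbed_zero_unique (he : ∀ θ, |e θ| ≤ 1 / 10000 * |sin θ|)
    (hlip : ∀ θ₁ θ₂, |e θ₁ - e θ₂| ≤ 1 / 10000 * |θ₁ - θ₂|) {θ₁ θ₂ : ℝ}
    (h₁ : θ₁ ∈ Set.Ioo 0 π) (h₂ : θ₂ ∈ Set.Ioo 0 π)
    (hc₁ : |cos θ₁| ≤ 7 / 8) (hc₂ : |cos θ₂| ≤ 7 / 8)
    (hexp : 2 * |cos θ₁ - cos θ₂| ≤ |cos (2 * π * cos θ₁) - cos (2 * π * cos θ₂)|)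
    (hz₁ : cos (2 * π * cos θ₁) * sinh (2 * π * sin θ₁) + e θ₁ = 0)
    (hz₂ : cos (2 * π * cos θ₂) * sinh (2 * π * sin θ₂) + e θ₂ = 0) : θ₁ = θ₂ := by
  by_contra hne
  wlog hlt : θ₁ < θ₂ generalizing θ₁ θ₂
  · refine this h₂ h₁ hc₂ hc₁ ?_ hz₂ hz₁ (Ne.symm hne) (lt_of_le_of_ne (not_lt.mp hlt) (Ne.symm hne))
    rwa [abs_sub_comm, abs_sub_comm (cos (2 * π * cos θ₂))]
  have hx := two_fifths_mul_sub_le_cos_sub h₁ h₂ hc₁ hc₂ hlt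
  have hc := abs_cos_le_of_perturbed_zero he h₂ hz₂
  have hs₁ : 2 ≤ sinh (2 * π * sin θ₁) := by
    refine le_trans ?_ (self_le_sinh_iff.mpr
      (mul_nonneg two_pi_pos.le (sin_pos_of_mem_Ioo h₁).le))
    nlinarith [pi_gt_three, two_fifths_le_sin h₁ hc₁]
  have hbound : ∀ θ, |2 * π * sin θ| ≤ 2 * π := fun θ => by
    rw [abs_mul, abs_of_pos two_pi_pos]
    exact mul_le_of_le_one_right two_pi_pos.le (abs_sin_le_one θ)
  have hsinh : |sinh (2 * π * sin θ₂) - sinh (2 * π * sin θ₁)| ≤ 7000 * |θ₁ - θ₂| := by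
    refine (abs_sinh_sub_sinh_le (hbound θ₂) (hbound θ₁)).trans ?_
    rw [← mul_sub, abs_mul, abs_of_pos two_pi_pos, ← mul_assoc, abs_sub_comm]
    have hl := Real.abs_sin_sub_sin_le θ₁ θ₂
    gcongr
    nlinarith [cosh_two_pi_lt, pi_lt_d2, pi_pos]
  have hd : 0 < |θ₁ - θ₂| := abs_pos.mpr (sub_ne_zero.mpr hne)
  have hdecomp : (cos (2 * π * cos θ₁) - cos (2 * π * cos θ₂)) * sinh (2 * π * sin θ₁)
      = -(e θ₁ - e θ₂)
        + cos (2 * π * cos θ₂) * (sinh (2 * π * sin θ₂) - sinh (2 * π * sin θ₁)) := by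
    linear_combination hz₁ - hz₂
  have hupper : |cos (2 * π * cos θ₁) - cos (2 * π * cos θ₂)| * sinh (2 * π * sin θ₁)
      ≤ 1 / 10000 * |θ₁ - θ₂| + 1 / 10000 * (7000 * |θ₁ - θ₂|) := by
    have := congrArg abs hdecomp
    rw [abs_mul, abs_of_pos (show 0 < sinh (2 * π * sin θ₁) by linarith)] at this
    rw [this]
    refine (abs_add_le _ _).trans ?_
    rw [abs_neg, abs_mul]
    gcongr
    exact hlip θ₁ θ₂
  nlinarith [mul_le_mul (hexp.trans' (mul_le_mul_of_nonneg_left hx zero_le_two)) hs₁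
    zero_le_two (abs_nonneg _)]

/-- The four arcs of the upper half circle on which zeros can lie each contain at most one. -/
theorem perturbed_zeros_subset (he : ∀ θ, |e θ| ≤ 1 / 10000 * |sin θ|)
    (hlip : ∀ θ₁ θ₂, |e θ₁ - e θ₂| ≤ 1 / 10000 * |θ₁ - θ₂|) :
    ∃ l : List ℝ, l.length = 4 ∧ ∀ θ ∈ Set.Ioo 0 π,
      cos (2 * π * cos θ) * sinh (2 * π * sin θ) + e θ = 0 → θ ∈ l := by
  have hpick : ∀ (s a : ℝ), |s| = 1 → a = 0 ∨ a = 1 / 2 → ∃ α, ∀ θ ∈ Set.Ioo 0 π,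
      cos (2 * π * cos θ) * sinh (2 * π * sin θ) + e θ = 0 →
      s * cos θ - a ∈ Set.Icc (1 / 8 : ℝ) (3 / 8) → θ = α := by
    intro s a hs ha
    by_cases hne : ∃ α ∈ Set.Ioo 0 π,
      cos (2 * π * cos α) * sinh (2 * π * sin α) + e α = 0 ∧
      s * cos α - a ∈ Set.Icc (1 / 8 : ℝ) (3 / 8)
    · obtain ⟨α, hα, hzα, hmα⟩ := hne
      refine ⟨α, fun θ hθ hz hm => ?_⟩
      have hle : ∀ t, s * cos t - a ∈ Set.Icc (1 / 8 : ℝ) (3 / 8) → |cos t| ≤ 7 / 8 := by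
        rintro t ⟨ht1, ht2⟩
        rw [← one_mul |cos t|, ← hs, ← abs_mul, abs_le]
        rcases ha with rfl | rfl <;> constructor <;> linarith
      have hshift : ∀ t, cos (2 * π * cos t)
          = (if a = 0 then 1 else -1) * cos (2 * π * (s * cos t - a)) := by
        intro t
        have hsign : cos (2 * π * cos t) = cos (2 * π * (s * cos t)) := by
          rcases (abs_eq zero_le_one).mp hs with rfl | rfl
          · rw [one_mul]
          · rw [← cos_neg]; congr 1; ring
        rw [hsign]
        rcases ha with rfl | rfl
        · simp
        · have := cos_two_pi_mul_add_half (s * cos t - 1 / 2)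
          rw [sub_add_cancel] at this
          rw [this]; norm_num
      refine perturbed_zero_unique he hlip hθ hα (hle θ hm) (hle α hmα) ?_ hz hzα
      rw [hshift θ, hshift α, ← mul_sub, abs_mul, apply_ite abs, abs_neg, abs_one, ite_self, one_mul]
      refine le_trans (le_of_eq ?_) (two_mul_abs_sub_le_abs_cos_sub hm hmα)
      rw [show s * cos θ - a - (s * cos α - a) = s * (cos θ - cos α) by ring, abs_mul, hs, one_mul]
    · exact ⟨0, fun θ hθ hz hm => absurd ⟨θ, hθ, hz, hm⟩ hne⟩
  obtain ⟨α₁, h₁⟩ := hpick 1 0 (by simp) (.inl rfl)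
  obtain ⟨α₂, h₂⟩ := hpick (-1) 0 (by simp) (.inl rfl)
  obtain ⟨α₃, h₃⟩ := hpick 1 (1 / 2) (by simp) (.inr rfl)
  obtain ⟨α₄, h₄⟩ := hpick (-1) (1 / 2) (by simp) (.inr rfl)
  refine ⟨[α₁, α₂, α₃, α₄], rfl, fun θ hθ hz => ?_⟩
  have hsmall : |cos (2 * π * cos θ)| < 1 / 2 :=
    (abs_cos_le_of_perturbed_zero he hθ hz).trans_lt (by norm_num)
  simp only [List.mem_cons, List.not_mem_nil, or_false]
  rcases abs_mem_of_abs_cos_two_pi_mul_lt (abs_cos_le_one θ) hsmall with h | h <;>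
    rcases abs_choice (cos θ) with hc | hc <;> rw [hc] at h <;> obtain ⟨ha, hb⟩ := h
  · exact .inl (h₁ θ hθ hz ⟨by linarith, by linarith⟩)
  · exact .inr (.inl (h₂ θ hθ hz ⟨by linarith, by linarith⟩))
  · exact .inr (.inr (.inl (h₃ θ hθ hz ⟨by linarith, by linarith⟩)))
  · exact .inr (.inr (.inr (h₄ θ hθ hz ⟨by linarith, by linarith⟩)))

theorem finite_and_ncard_perturbed_zeros_le (he : ∀ θ, |e θ| ≤ 1 / 10000 * |sin θ|)
    (hlip : ∀ θ₁ θ₂, |e θ₁ - e θ₂| ≤ 1 / 10000 * |θ₁ - θ₂|)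
    (hodd : ∀ θ, e (2 * π - θ) = -e θ) {f : ℝ → ℝ}
    (hf : ∀ θ, f θ = cos (2 * π * cos θ) * sinh (2 * π * sin θ) + e θ) :
    {θ : ℝ | θ ∈ Set.Ico 0 (2 * π) ∧ f θ = 0}.Finite ∧
    {θ : ℝ | θ ∈ Set.Ico 0 (2 * π) ∧ f θ = 0}.ncard ≤ 10 := by
  obtain ⟨l, hl, hmem⟩ := perturbed_zeros_subset he hlip
  have hsub : {θ : ℝ | θ ∈ Set.Ico 0 (2 * π) ∧ f θ = 0}
      ⊆ ((0 :: π :: (l ++ l.map (2 * π - ·))).toFinset : Set ℝ) := by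
    rintro θ ⟨⟨h0, h2⟩, hz⟩
    rw [hf] at hz
    simp only [List.coe_toFinset, Set.mem_ofPred_eq, List.mem_cons, List.mem_append, List.mem_map]
    rcases h0.eq_or_lt with h | h0
    · exact .inl h.symm
    rcases lt_trichotomy θ π with h | h | h
    · exact .inr (.inr (.inl (hmem θ ⟨h0, h⟩ hz)))
    · exact .inr (.inl h)
    · refine .inr (.inr (.inr ⟨2 * π - θ, hmem _ ⟨by linarith, by linarith⟩ ?_, by ring⟩))
      rw [hodd, cos_two_pi_sub, sin_two_pi_sub, mul_neg, sinh_neg]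
      linarith
  refine ⟨(Finset.finite_toSet _).subset hsub,
    (Set.ncard_le_ncard hsub (Finset.finite_toSet _)).trans ?_⟩
  rw [Set.ncard_coe_finset]
  refine (List.toFinset_card_le _).trans ?_
  simp [hl]

end PerturbedSine

/-- A Dirichlet series with `a 1 = 1` and Deligne-type coefficients is close to `1`. -/
theorem abs_tsum_sub_one_le {a : ℕ → ℝ} (ha1 : a 1 = 1) {κ σ : ℝ}
    (hbd : ∀ n : ℕ, 1 ≤ n → |a n| ≤ (n.divisors.card : ℝ) * (n : ℝ) ^ κ) (hσ : κ + 3 ≤ σ) :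
    |∑' n : ℕ, a (n + 1) / ((n : ℝ) + 1) ^ σ - 1| ≤ 2 ^ (κ + 3 - σ) := by
  have hterm : ∀ n : ℕ, |a (n + 1 + 1) / (((n + 1 : ℕ) : ℝ) + 1) ^ σ|
      ≤ 2 ^ (κ + 3 - σ) * (1 / ((n + 2 : ℕ) : ℝ) ^ 2) := by
    intro n
    have hx : (2 : ℝ) ≤ ((n + 2 : ℕ) : ℝ) := by push_cast; linarith [n.cast_nonneg (α := ℝ)]
    have hcast : (((n + 1 : ℕ) : ℝ) + 1) = ((n + 2 : ℕ) : ℝ) := by push_cast; ring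
    rw [hcast]
    have ha := hbd (n + 2) (by omega)
    have hd : ((n + 2).divisors.card : ℝ) ≤ ((n + 2 : ℕ) : ℝ) := by
      exact_mod_cast Nat.card_divisors_le_self _
    set x : ℝ := ((n + 2 : ℕ) : ℝ)
    have hx0 : 0 < x := by linarith
    have hpow : x ^ (κ + 3 - σ) ≤ 2 ^ (κ + 3 - σ) :=
      rpow_le_rpow_of_nonpos two_pos hx (by linarith)
    have hσ0 : 0 < x ^ σ := rpow_pos_of_pos hx0 _
    rw [abs_div, abs_of_pos hσ0, div_le_iff₀ hσ0]
    have hsplit : x ^ (κ + 3 - σ) * (1 / x ^ 2) * x ^ σ = x * x ^ κ := by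
      rw [rpow_sub hx0, rpow_add hx0, show (3 : ℝ) = ((3 : ℕ) : ℝ) by norm_num, rpow_natCast]
      field_simp
    calc |a (n + 1 + 1)| ≤ x * x ^ κ := ha.trans (by gcongr)
      _ = x ^ (κ + 3 - σ) * (1 / x ^ 2) * x ^ σ := hsplit.symm
      _ ≤ _ := by gcongr
  have hz : HasSum (fun n : ℕ => 1 / ((n + 2 : ℕ) : ℝ) ^ 2) (π ^ 2 / 6 - 1) := by
    have := (hasSum_nat_add_iff' 2).mpr hasSum_zeta_two
    simpa [Finset.sum_range_succ] using this
  have hmaj := hz.mul_left (2 ^ (κ + 3 - σ) : ℝ)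
  have hs1 : Summable fun n : ℕ => a (n + 1 + 1) / (((n + 1 : ℕ) : ℝ) + 1) ^ σ :=
    Summable.of_norm_bounded hmaj.summable hterm
  have hs : Summable fun n : ℕ => a (n + 1) / ((n : ℝ) + 1) ^ σ := (summable_nat_add_iff 1).mp hs1
  rw [hs.tsum_eq_zero_add]
  have h0 : a (0 + 1) / (((0 : ℕ) : ℝ) + 1) ^ σ = 1 := by simp [ha1]
  rw [h0, add_sub_cancel_left]
  refine (hs1.hasSum.norm_le_of_bounded hmaj hterm).trans ?_
  have hp : π ^ 2 / 6 - 1 ≤ 1 := by nlinarith [pi_lt_d2, pi_gt_three]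
  exact mul_le_of_le_one_right (by positivity) hp

/-- With `q` as in Statement 12, the set of `θ ∈ [0, 2π)` where
`Im q(e^{iθ}) = 0` has at most `10` elements. -/
theorem im_q_at_most_ten_zeros
    (k : ℕ) (hk : 80 ≤ k) (hk4 : k % 4 = 2)
    (a : ℕ → ℝ) (ha1 : a 1 = 1)
    (hbd : ∀ n : ℕ, 1 ≤ n →
      |a n| ≤ (n.divisors.card : ℝ) * (n : ℝ) ^ (((k : ℝ) - 1) / 2))
    (L : ℝ → ℝ)
    (hL : ∀ σ : ℝ, ((k : ℝ) + 1) / 2 < σ →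
      L σ = ∑' n : ℕ, a (n + 1) / ((n : ℝ) + 1) ^ σ)
    (q : ℂ → ℂ)
    (hq : ∀ z : ℂ, q z = ∑ m ∈ Finset.range ((k - 2 - 6) / 4 + 1),
      (-1) ^ m * (2 * (π : ℂ) * z) ^ (2 * m + 1) / ((2 * m + 1).factorial : ℂ)
        * ((L ((k - 2 - 2 * m : ℕ) : ℝ) : ℂ))) :
    {θ : ℝ | θ ∈ Set.Ico 0 (2 * π) ∧
      (q (Complex.exp ((θ : ℝ) * Complex.I))).im = 0}.Finite ∧
    {θ : ℝ | θ ∈ Set.Ico 0 (2 * π) ∧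
      (q (Complex.exp ((θ : ℝ) * Complex.I))).im = 0}.ncard ≤ 10 := by
  set N := (k - 2 - 6) / 4 + 1 with hN
  set b : ℕ → ℝ := fun m => (if m ∈ Finset.range N then L ((k - 2 - 2 * m : ℕ) : ℝ) else 0) - 1
    with hb
  have hbound : ∀ m, |b m| ≤ 2⁻¹ ^ 36 * 4 ^ m := by
    intro m
    by_cases hm : m ∈ Finset.range N
    · have hmN : 4 * m + 10 ≤ k := by have := Finset.mem_range.mp hm; omega
      have hcast : ((k - 2 - 2 * m : ℕ) : ℝ) = (k : ℝ) - 2 - 2 * m := by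
        rw [Nat.cast_sub (by omega), Nat.cast_sub (by omega)]; push_cast; ring
      have hmR : 4 * (m : ℝ) + 10 ≤ k := by exact_mod_cast hmN
      have hkR : (82 : ℝ) ≤ k := by exact_mod_cast (show 82 ≤ k by omega)
      simp only [hb, if_pos hm]
      rw [hL _ (by rw [hcast]; linarith)]
      refine (abs_tsum_sub_one_le ha1 hbd (by rw [hcast]; linarith)).trans ?_
      have hpow : (2⁻¹ : ℝ) ^ 36 * 4 ^ m = 2 ^ (2 * (m : ℝ) - 36) := by
        rw [rpow_sub two_pos, rpow_mul zero_le_two, rpow_natCast]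
        norm_num [div_eq_inv_mul]
      rw [hpow, hcast]
      exact rpow_le_rpow_of_exponent_le one_le_two (by linarith)
    · have hmN : 18 ≤ m := by have := mt Finset.mem_range.mpr hm; omega
      simp only [hb, if_neg hm]
      calc |(0 : ℝ) - 1| = 2⁻¹ ^ 36 * 4 ^ 18 := by norm_num
        _ ≤ 2⁻¹ ^ 36 * 4 ^ m := by gcongr; norm_num
  obtain ⟨K, hK, hKsum⟩ := exists_hasSum_majorant_le hbound
  set e : ℝ → ℝ := fun θ => (q (Complex.exp (θ * Complex.I))).im
    - cos (2 * π * cos θ) * sinh (2 * π * sin θ) with he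
  have hsum : ∀ θ, HasSum (fun m : ℕ => sinCoeff m * b m * sin ((2 * m + 1 : ℕ) * θ)) (e θ) := by
    intro θ
    have h1 : HasSum (fun m : ℕ => if m ∈ Finset.range N then
        sinCoeff m * L ((k - 2 - 2 * m : ℕ) : ℝ) * sin ((2 * m + 1 : ℕ) * θ) else 0)
        (q (Complex.exp (θ * Complex.I))).im := by
      rw [hq, Complex.im_sum]
      rw [Finset.sum_congr rfl fun m hm => (im_sin_term θ _ m).trans (if_pos hm).symm]
      exact hasSum_sum_of_ne_finset_zero fun m hm => if_neg hm
    refine (h1.sub (hasSum_im_sin θ)).congr_fun fun m => ?_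
    simp only [hb]
    split_ifs <;> ring
  refine finite_and_ncard_perturbed_zeros_le (e := e) (fun θ => ?_) (fun θ₁ θ₂ => ?_)
    (fun θ => ?_) (fun θ => by simp only [he]; ring)
  · exact (abs_le_of_hasSum_sin hKsum (hsum θ)).trans (by gcongr)
  · exact (abs_sub_le_of_hasSum_sin hKsum (hsum θ₁) (hsum θ₂)).trans (by gcongr)
  · refine (hsum (2 * π - θ)).unique ((hsum θ).neg.congr_fun fun m => ?_)
    rw [← mul_neg, ← sin_nat_mul_two_pi_sub]
    congr 2
    ring
end

section
/- Let k ≥ 12 be an even integer, let w = k − 2, and let f be a cusp form of weight k for SL(2,ℤ). Define the period polynomial r_f(X) = ∫_0^∞ f(it)·(X − it)^w dt. Then for every complex X ∉ {0, 1}, r_f(X) + X^w·r_f(1 − 1/X) + (X − 1)^w·r_f(−1/(X − 1)) = 0. -/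
open Real Complex UpperHalfPlane MatrixGroups MeasureTheory

open Filter Topology Set

/-- A holomorphic function on the upper half plane has a primitive there. -/
lemma exists_primitive_upperHalfPlane {h : ℂ → ℂ} (hh : DifferentiableOn ℂ h {z | 0 < z.im}) :
    ∃ P : ℂ → ℂ, ∀ z : ℂ, 0 < z.im → HasDerivAt P (h z) z := by
  have one_sub_ne : ∀ ζ ∈ Metric.ball (0 : ℂ) 1, 1 - ζ ≠ 0 := by
    intro ζ hζ h0
    have : ζ = 1 := (sub_eq_zero.mp h0).symm
    simp [this] at hζ
  have maps : MapsTo (fun ζ : ℂ ↦ Complex.I * (1 + ζ) / (1 - ζ)) (Metric.ball 0 1) {z | 0 < z.im} := by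
    intro ζ hζ
    have h1 : 0 < normSq (1 - ζ) := normSq_pos.mpr (one_sub_ne ζ hζ)
    have h2 : normSq ζ < 1 := by
      rw [normSq_eq_norm_sq]
      have : ‖ζ‖ < 1 := by simpa using hζ
      nlinarith [norm_nonneg ζ]
    have h3 : (Complex.I * (1 + ζ) / (1 - ζ)).im = (1 - normSq ζ) / normSq (1 - ζ) := by
      rw [div_im]
      field_simp
      simp [normSq_apply]
      ring
    change 0 < (Complex.I * (1 + ζ) / (1 - ζ)).im
    rw [h3]
    exact div_pos (by linarith) h1
  have hdiff : DifferentiableOn ℂ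
      (fun ζ : ℂ ↦ h (Complex.I * (1 + ζ) / (1 - ζ)) * (2 * Complex.I / (1 - ζ) ^ 2)) (Metric.ball 0 1) := by
    refine DifferentiableOn.mul (hh.comp ?_ maps) ?_
    · exact DifferentiableOn.div (by fun_prop) (by fun_prop) one_sub_ne
    · exact DifferentiableOn.div (by fun_prop) (by fun_prop)
        fun ζ hζ ↦ pow_ne_zero 2 (one_sub_ne ζ hζ)
  obtain ⟨H, hH⟩ := hdiff.isExactOn_ball
  refine ⟨fun z ↦ H ((z - Complex.I) / (z + Complex.I)), fun z hz ↦ ?_⟩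
  have hzI : z + Complex.I ≠ 0 := by
    intro h0
    have := congrArg Complex.im h0
    simp at this
    linarith
  have hmem : (z - Complex.I) / (z + Complex.I) ∈ Metric.ball (0 : ℂ) 1 := by
    have h1 : 0 < ‖z + Complex.I‖ := norm_pos_iff.mpr hzI
    rw [mem_ball_zero_iff, norm_div, div_lt_one h1, ← sq_lt_sq₀ (norm_nonneg _) (norm_nonneg _),
      ← normSq_eq_norm_sq, ← normSq_eq_norm_sq]
    simp [normSq_apply]
    nlinarith
  have hinner : HasDerivAt (fun z : ℂ ↦ (z - Complex.I) / (z + Complex.I)) (2 * Complex.I / (z + Complex.I) ^ 2) z := by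
    convert! ((hasDerivAt_id z).sub_const Complex.I).div ((hasDerivAt_id z).add_const Complex.I) hzI using 1
    simp only [id]
    ring
  have hsub : 1 - (z - Complex.I) / (z + Complex.I) = 2 * Complex.I / (z + Complex.I) := by
    field_simp
    ring
  have hback : Complex.I * (1 + (z - Complex.I) / (z + Complex.I)) / (1 - (z - Complex.I) / (z + Complex.I)) = z := by
    rw [hsub]
    field_simp
    ring
  have hcomp := (hH _ hmem).comp z hinner
  convert! hcomp using 1
  beta_reduce
  rw [hback, hsub]
  field_simp

section EichlerIntegral

variable {w : ℕ} {g : ℂ → ℂ} {a b : ℂ} {A C : ℝ}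

lemma norm_mul_affine_pow_le (hA : 1 ≤ A)
    (hC : ∀ z : ℂ, A ≤ z.im → ‖g z‖ * z.im ^ (w + 2) ≤ C) (a b : ℂ)
    {z : ℂ} (h0 : 0 ≤ z.re) (h1 : z.re ≤ 1) (hz : A ≤ z.im) :
    ‖g z * (a * z + b) ^ w‖ ≤ C * (2 * ‖a‖ + ‖b‖) ^ w * (z.im ^ 2)⁻¹ := by
  have hpos : 0 < z.im := by linarith
  have hz1 : 1 ≤ z.im := hA.trans hz
  have hnz : ‖z‖ ≤ 2 * z.im := by
    refine (norm_le_abs_re_add_abs_im z).trans ?_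
    rw [abs_of_nonneg h0, abs_of_pos hpos]
    linarith
  have haff : ‖a * z + b‖ ≤ (2 * ‖a‖ + ‖b‖) * z.im := by
    refine (norm_add_le _ _).trans ?_
    rw [norm_mul]
    nlinarith [norm_nonneg a, norm_nonneg b, mul_le_mul_of_nonneg_left hnz (norm_nonneg a),
      mul_le_mul_of_nonneg_left hz1 (norm_nonneg b)]
  rw [norm_mul, norm_pow, ← div_eq_mul_inv, le_div_iff₀ (by positivity)]
  calc ‖g z‖ * ‖a * z + b‖ ^ w * z.im ^ 2
      ≤ ‖g z‖ * ((2 * ‖a‖ + ‖b‖) * z.im) ^ w * z.im ^ 2 := by gcongr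
    _ = ‖g z‖ * z.im ^ (w + 2) * (2 * ‖a‖ + ‖b‖) ^ w := by rw [mul_pow]; ring
    _ ≤ C * (2 * ‖a‖ + ‖b‖) ^ w := by gcongr; exact hC z hz

lemma tendsto_primitive_sub_translate (hA : 1 ≤ A)
    (hC : ∀ z : ℂ, A ≤ z.im → ‖g z‖ * z.im ^ (w + 2) ≤ C) {Q : ℂ → ℂ}
    (hQ : ∀ z : ℂ, 0 < z.im → HasDerivAt Q (g z * (a * z + b) ^ w) z) :
    Tendsto (fun T : ℝ ↦ Q (Complex.I * T) - Q (1 + Complex.I * T)) atTop (𝓝 0) := by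
  have hlim : Tendsto (fun T : ℝ ↦ C * (2 * ‖a‖ + ‖b‖) ^ w * (T ^ 2)⁻¹) atTop (𝓝 0) := by
    simpa using ((tendsto_pow_atTop two_ne_zero).inv_tendsto_atTop).const_mul
      (C * (2 * ‖a‖ + ‖b‖) ^ w)
  refine squeeze_zero_norm' ?_ hlim
  filter_upwards [eventually_ge_atTop A] with T hT
  have hconv : Convex ℝ {z : ℂ | (0 ≤ z.re ∧ z.re ≤ 1) ∧ z.im = T} :=
    ((convex_halfSpace_re_ge 0).inter (convex_halfSpace_re_le 1)).inter
      (convex_hyperplane (f := Complex.im) imLm.isLinear T)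
  have := hconv.norm_image_sub_le_of_norm_hasDerivWithin_le (f := Q)
    (f' := fun z ↦ g z * (a * z + b) ^ w) (C := C * (2 * ‖a‖ + ‖b‖) ^ w * (T ^ 2)⁻¹)
    (x := 1 + Complex.I * T) (y := Complex.I * T)
    (fun z hz ↦ (hQ z (by rw [hz.2]; linarith)).hasDerivWithinAt)
    (fun z hz ↦ by
      have := norm_mul_affine_pow_le hA hC a b hz.1.1 hz.1.2 (by rw [hz.2]; exact hT)
      rwa [hz.2] at this)
    (by simp) (by simp)
  simpa using this

lemma integrableOn_imaginary_axis (hg : DifferentiableOn ℂ g {z | 0 < z.im})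
    (hS : ∀ z : ℂ, 0 < z.im → g (-1 / z) = z ^ (w + 2) * g z) (hA : 1 ≤ A)
    (hC : ∀ z : ℂ, A ≤ z.im → ‖g z‖ * z.im ^ (w + 2) ≤ C) (a b : ℂ) :
    IntegrableOn (fun t : ℝ ↦ g (Complex.I * t) * (a * (Complex.I * t) + b) ^ w) (Ioi 0) := by
  have hA0 : 0 < A := by linarith
  have hcont : ContinuousOn (fun t : ℝ ↦ g (Complex.I * t) * (a * (Complex.I * t) + b) ^ w) (Ioi 0) := by
    refine ContinuousOn.mul (hg.continuousOn.comp (by fun_prop) fun t ht ↦ ?_) (by fun_prop)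
    simpa using ht
  have hzero : IntegrableOn (fun t : ℝ ↦ g (Complex.I * t) * (a * (Complex.I * t) + b) ^ w) (Ioc 0 A⁻¹) := by
    refine Integrable.mono' (integrableOn_const (C := C * (‖a‖ + ‖b‖) ^ w) (by simp) (by finiteness))
      ((hcont.mono Ioc_subset_Ioi_self).aestronglyMeasurable measurableSet_Ioc) ?_
    refine (ae_restrict_mem measurableSet_Ioc).mono fun t ht ↦ ?_
    have ht0 : 0 < t := ht.1
    have hAt : A ≤ t⁻¹ := (le_inv_comm₀ ht0 hA0).mp ht.2
    have ht1 : t ≤ 1 := ht.2.trans (inv_le_one_of_one_le₀ hA)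
    have him : (Complex.I * (t⁻¹ : ℝ)).im = t⁻¹ := by simp
    have hgt : ‖g (Complex.I * t)‖ ≤ C := by
      have h1 := hS (Complex.I * (t⁻¹ : ℝ)) (by rw [him]; positivity)
      have h2 : -1 / (Complex.I * ((t⁻¹ : ℝ) : ℂ)) = Complex.I * t := by
        have : (t : ℂ) ≠ 0 := by exact_mod_cast ht0.ne'
        push_cast
        field_simp
        simp
      have h3 := hC (Complex.I * (t⁻¹ : ℝ)) (by rw [him]; exact hAt)
      rw [him] at h3
      rw [h2] at h1
      rw [h1, norm_mul, norm_pow, norm_mul, norm_I, one_mul, norm_real, Real.norm_of_nonneg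
        (by positivity), mul_comm]
      exact h3
    have haff : ‖a * (Complex.I * t) + b‖ ≤ ‖a‖ + ‖b‖ := by
      refine (norm_add_le _ _).trans ?_
      rw [norm_mul, norm_mul, norm_I, one_mul, norm_real, Real.norm_of_nonneg ht0.le]
      nlinarith [norm_nonneg a]
    rw [norm_mul, norm_pow]
    have := (norm_nonneg _).trans hgt
    gcongr
  have hmid : IntegrableOn (fun t : ℝ ↦ g (Complex.I * t) * (a * (Complex.I * t) + b) ^ w) (Icc A⁻¹ A) :=
    (hcont.mono fun t ht ↦ (inv_pos.mpr hA0).trans_le ht.1).integrableOn_Icc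
  have htop : IntegrableOn (fun t : ℝ ↦ g (Complex.I * t) * (a * (Complex.I * t) + b) ^ w) (Ioi A) := by
    have hint : IntegrableOn (fun t : ℝ ↦ C * (2 * ‖a‖ + ‖b‖) ^ w * (t ^ 2)⁻¹) (Ioi A) := by
      refine Integrable.const_mul ?_ _
      refine (integrableOn_Ioi_rpow_of_lt (a := -2) (by norm_num) hA0).congr_fun
        (fun t ht ↦ ?_) measurableSet_Ioi
      have : 0 ≤ t := hA0.le.trans (le_of_lt ht)
      simp [Real.rpow_neg this]
    refine hint.mono' ((hcont.mono (Ioi_subset_Ioi hA0.le)).aestronglyMeasurable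
      measurableSet_Ioi) ?_
    refine (ae_restrict_mem measurableSet_Ioi).mono fun t ht ↦ ?_
    have := norm_mul_affine_pow_le hA hC a b (z := Complex.I * t) (by simp) (by simp)
      (by simpa using le_of_lt ht)
    simpa using this
  refine ((hzero.union hmid).union htop).mono_set fun t ht ↦ ?_
  rcases le_or_gt t A⁻¹ with h | h
  · exact Or.inl (Or.inl ⟨ht, h⟩)
  · rcases le_or_gt t A with h' | h'
    · exact Or.inl (Or.inr ⟨h.le, h'⟩)
    · exact Or.inr h'

lemma tendsto_primitive_sub_inv (hg : DifferentiableOn ℂ g {z | 0 < z.im})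
    (hS : ∀ z : ℂ, 0 < z.im → g (-1 / z) = z ^ (w + 2) * g z) (hA : 1 ≤ A)
    (hC : ∀ z : ℂ, A ≤ z.im → ‖g z‖ * z.im ^ (w + 2) ≤ C) {Q : ℂ → ℂ}
    (hQ : ∀ z : ℂ, 0 < z.im → HasDerivAt Q (g z * (a * z + b) ^ w) z) :
    Tendsto (fun T : ℝ ↦ Q (Complex.I * T) - Q (Complex.I * (T⁻¹ : ℝ))) atTop
      (𝓝 (Complex.I * ∫ t in Ioi (0 : ℝ), g (Complex.I * t) * (a * (Complex.I * t) + b) ^ w)) := by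
  have hint := integrableOn_imaginary_axis hg hS hA hC a b
  have hcover : AECover (volume.restrict (Ioi (0 : ℝ))) atTop fun T : ℝ ↦ Ioc T⁻¹ T :=
    (aecover_Ioi_of_Ioi tendsto_inv_atTop_zero).inter (aecover_Iic tendsto_id)
  have hlim := (hcover.integral_tendsto_of_countably_generated hint).const_mul Complex.I
  refine hlim.congr' ?_
  filter_upwards [eventually_ge_atTop 1] with T hT
  have hT0 : 0 < T := by linarith
  have hle : T⁻¹ ≤ T := (inv_le_one_of_one_le₀ hT).trans hT
  have hsub : Ioc T⁻¹ T ⊆ Ioi 0 := fun t ht ↦ (inv_pos.mpr hT0).trans ht.1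
  rw [Measure.restrict_restrict measurableSet_Ioc, inter_eq_left.mpr hsub,
    ← intervalIntegral.integral_of_le hle, ← intervalIntegral.integral_const_mul]
  refine intervalIntegral.integral_eq_sub_of_hasDerivAt (f := fun t : ℝ ↦ Q (Complex.I * t))
    (fun t ht ↦ ?_) ?_
  · rw [uIcc_of_le hle] at ht
    have ht0 : 0 < t := (inv_pos.mpr hT0).trans_le ht.1
    have h1 : HasDerivAt (fun t : ℝ ↦ Complex.I * (t : ℂ)) Complex.I t := by
      simpa using (hasDerivAt_id t).ofReal_comp.const_mul Complex.I
    have h2 := (hQ (Complex.I * t) (by simpa using ht0)).comp t h1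
    rwa [mul_comm] at h2
  · rw [intervalIntegrable_iff_integrableOn_Ioc_of_le hle]
    exact (hint.mono_set hsub).const_mul Complex.I

/-- The three-term period relation for a holomorphic function on the upper half plane with the
transformation behaviour of a modular form of level one and weight `w + 2`, and sufficient decay
at the cusp. -/
theorem period_three_term_relation (hw : Even w) (hg : DifferentiableOn ℂ g {z | 0 < z.im})
    (hT : ∀ z : ℂ, 0 < z.im → g (z + 1) = g z)
    (hS : ∀ z : ℂ, 0 < z.im → g (-1 / z) = z ^ (w + 2) * g z) (hA : 1 ≤ A)
    (hC : ∀ z : ℂ, A ≤ z.im → ‖g z‖ * z.im ^ (w + 2) ≤ C) (X : ℂ) :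
    (∫ t in Ioi (0 : ℝ), g (Complex.I * t) * (-1 * (Complex.I * t) + X) ^ w)
      + (∫ t in Ioi (0 : ℝ), g (Complex.I * t) * (-X * (Complex.I * t) + (X - 1)) ^ w)
      + (∫ t in Ioi (0 : ℝ), g (Complex.I * t) * (-(X - 1) * (Complex.I * t) + -1) ^ w) = 0 := by
  obtain ⟨P, hP⟩ := exists_primitive_upperHalfPlane
    (h := fun z ↦ g z * (-1 * z + X) ^ w) (hg.mul (by fun_prop))
  have hne : ∀ z : ℂ, 0 < z.im → z ≠ 0 := fun z hz h ↦ by simp [h] at hz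
  have him_inv : ∀ z : ℂ, 0 < z.im → 0 < (-1 / z).im := fun z hz ↦ by
    have : 0 < normSq z := normSq_pos.mpr (hne z hz)
    simpa [neg_div] using div_pos hz this
  have hP₂ : ∀ z : ℂ, 0 < z.im → HasDerivAt (fun z ↦ P (-1 / (z - 1)))
      (g z * (-X * z + (X - 1)) ^ w) z := fun z hz ↦ by
    have hz1 : 0 < (z - 1).im := by simpa using hz
    have h0 := hne _ hz1
    have hinner : HasDerivAt (fun z : ℂ ↦ -1 / (z - 1)) (1 / (z - 1) ^ 2) z := by
      convert! (hasDerivAt_const z (-1 : ℂ)).div ((hasDerivAt_id z).sub_const 1) h0 using 1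
      simp
    convert! (hP _ (him_inv _ hz1)).comp z hinner using 1
    have hgz : g (z - 1) = g z := by simpa using (hT (z - 1) hz1).symm
    rw [hS _ hz1, hgz, show -X * z + (X - 1) = -((z - 1) * (-1 * (-1 / (z - 1)) + X)) by
      field_simp; ring, hw.neg_pow, mul_pow, pow_add]
    field_simp
  have hP₃ : ∀ z : ℂ, 0 < z.im → HasDerivAt (fun z ↦ P (-1 / z + 1))
      (g z * (-(X - 1) * z + -1) ^ w) z := fun z hz ↦ by
    have h0 := hne _ hz
    have hinner : HasDerivAt (fun z : ℂ ↦ -1 / z + 1) (1 / z ^ 2) z := by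
      convert! ((hasDerivAt_const z (-1 : ℂ)).div (hasDerivAt_id z) h0).add_const 1 using 1
      simp
    have him : 0 < (-1 / z + 1).im := by simpa using him_inv z hz
    convert! (hP _ him).comp z hinner using 1
    rw [hT _ (him_inv z hz), hS _ hz,
      show -(X - 1) * z + -1 = -(z * (-1 * (-1 / z + 1) + X)) by field_simp; ring,
      hw.neg_pow, mul_pow, pow_add]
    field_simp
  have hsum := ((tendsto_primitive_sub_inv hg hS hA hC hP).add
    (tendsto_primitive_sub_inv hg hS hA hC hP₂)).add (tendsto_primitive_sub_inv hg hS hA hC hP₃)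
  have hzero := ((tendsto_primitive_sub_translate hA hC hP).add
    (tendsto_primitive_sub_translate hA hC hP₂)).add (tendsto_primitive_sub_translate hA hC hP₃)
  have hlim := tendsto_nhds_unique_of_eventuallyEq hsum hzero (by
    filter_upwards [eventually_gt_atTop 0] with T hT0
    have hTc : (T : ℂ) ≠ 0 := by exact_mod_cast hT0.ne'
    have h1T : 1 + Complex.I * (T : ℂ) ≠ 0 := hne _ (by simpa using hT0)
    have e1 : Complex.I * ((T⁻¹ : ℝ) : ℂ) = -1 / (1 + Complex.I * T - 1) := by
      rw [add_sub_cancel_left]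
      push_cast
      field_simp
      linear_combination Complex.I_sq
    have e2 : -1 / (Complex.I * ((T⁻¹ : ℝ) : ℂ) - 1) = -1 / (1 + Complex.I * T) + 1 := by
      have hd : Complex.I * ((T⁻¹ : ℝ) : ℂ) - 1 = Complex.I * (1 + Complex.I * T) / T := by
        push_cast
        field_simp
        linear_combination (-(T : ℂ)) * I_sq
      rw [hd]
      field_simp
      linear_combination (-(T : ℂ)) * I_sq
    have e3 : -1 / (Complex.I * ((T⁻¹ : ℝ) : ℂ)) + 1 = 1 + Complex.I * T := by
      push_cast
      field_simp
      linear_combination (-(T : ℂ)) * I_sq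
    simp only [e2, e3]
    rw [← e1]
    ring)
  have h0 : Complex.I * ((∫ t in Ioi (0 : ℝ), g (Complex.I * t) * (-1 * (Complex.I * t) + X) ^ w)
      + (∫ t in Ioi (0 : ℝ), g (Complex.I * t) * (-X * (Complex.I * t) + (X - 1)) ^ w)
      + (∫ t in Ioi (0 : ℝ), g (Complex.I * t) * (-(X - 1) * (Complex.I * t) + -1) ^ w)) = 0 := by
    linear_combination hlim
  exact (mul_eq_zero.mp h0).resolve_left I_ne_zero

end EichlerIntegral

section CuspForm

variable {k : ℕ} (f : CuspForm (⊤ : Subgroup SL(2, ℤ)) (k : ℤ))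

lemma one_mem_strictPeriods_top :
    (1 : ℝ) ∈ ((⊤ : Subgroup SL(2, ℤ)) : Subgroup (GL (Fin 2) ℝ)).strictPeriods := by
  rw [← MonoidHom.range_eq_map]
  exact one_mem_strictPeriods_SL

lemma cuspForm_comp_ofComplex_inv (z : ℂ) (hz : 0 < z.im) :
    (f ∘ ofComplex) (-1 / z) = z ^ k * (f ∘ ofComplex) z := by
  have h := SlashInvariantForm.slash_action_eqn_SL'' f
    (Subgroup.mem_top ModularGroup.S) ⟨z, hz⟩
  rw [modular_S_smul, ModularGroup.denom_S] at h
  have h2 : 0 < (-1 / z).im := by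
    have := im_inv_neg_coe_pos ⟨z, hz⟩
    simpa [neg_div] using this
  have h3 : (-1 / z) = (-z)⁻¹ := by rw [neg_div, one_div, inv_neg]
  simp only [Function.comp_apply, ofComplex_apply_of_im_pos hz, ofComplex_apply_of_im_pos h2]
  simp only [h3]
  simpa using h

lemma cuspForm_comp_ofComplex_add_one (z : ℂ) :
    (f ∘ ofComplex) (z + 1) = (f ∘ ofComplex) z := by
  simpa using SlashInvariantFormClass.periodic_comp_ofComplex f one_mem_strictPeriods_top z

lemma exists_cuspForm_decay : ∃ A C : ℝ, 1 ≤ A ∧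
    ∀ z : ℂ, A ≤ z.im → ‖(f ∘ ofComplex) z‖ * z.im ^ k ≤ C := by
  have h := CuspFormClass.exp_decay_atImInfty f one_pos one_mem_strictPeriods_top
  obtain ⟨c, hc⟩ := h.bound
  obtain ⟨B, hB⟩ := atImInfty_mem _ |>.mp hc
  have hlim := Real.tendsto_pow_mul_exp_neg_atTop_nhds_zero k
  obtain ⟨D, hD⟩ := eventually_atTop.mp (hlim.eventually (ge_mem_nhds one_pos))
  refine ⟨max 1 (max B D), |c|, le_max_left _ _, fun z hz ↦ ?_⟩
  have h1 : 1 ≤ z.im := (le_max_left _ _).trans hz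
  have hBz : B ≤ z.im := (le_max_left _ _).trans ((le_max_right _ _).trans hz)
  have hDz : D ≤ z.im := (le_max_right _ _).trans ((le_max_right _ _).trans hz)
  have hpos : 0 < z.im := by linarith
  have hbound : ‖f ⟨z, hpos⟩‖ ≤ c * ‖Real.exp (-2 * π * z.im / 1)‖ := hB ⟨z, hpos⟩ hBz
  rw [Function.comp_apply, ofComplex_apply_of_im_pos hpos]
  rw [Real.norm_of_nonneg (Real.exp_pos _).le] at hbound
  have hexp : Real.exp (-2 * π * z.im / 1) ≤ Real.exp (-z.im) := by
    gcongr
    nlinarith [Real.pi_gt_three]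
  calc ‖f ⟨z, hpos⟩‖ * z.im ^ k ≤ |c| * Real.exp (-z.im) * z.im ^ k := by
        gcongr
        refine hbound.trans ?_
        gcongr
        exact le_abs_self c
    _ = |c| * (z.im ^ k * Real.exp (-z.im)) := by ring
    _ ≤ |c| * 1 := by gcongr; exact hD _ hDz
    _ = |c| := mul_one _

end CuspForm

/-- Eichler–Shimura relation `r_f|(1+U+U²) = 0`: for a cusp form `f` of
even weight `k ≥ 12` for `SL(2,ℤ)` and `w = k - 2`, the period polynomial
`r_f(X) = ∫_0^∞ f(it) (X - it)^w dt` satisfies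
`r_f(X) + X^w r_f(1 - 1/X) + (X-1)^w r_f(-1/(X-1)) = 0` for `X ∉ {0, 1}`. -/
theorem period_relation_U
    (k : ℕ) (hk : 12 ≤ k) (hkeven : Even k)
    (f : CuspForm (⊤ : Subgroup SL(2, ℤ)) (k : ℤ))
    (F : ℝ → ℂ)
    (hF : ∀ (t : ℝ) (ht : 0 < t),
      F t = f (⟨Complex.I * t, by simpa using ht⟩ : UpperHalfPlane))
    (R : ℂ → ℂ)
    (hR : ∀ X : ℂ, R X = ∫ t in Set.Ioi (0 : ℝ), F t * (X - Complex.I * t) ^ (k - 2)) :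
    ∀ X : ℂ, X ≠ 0 → X ≠ 1 →
      R X + X ^ (k - 2) * R (1 - 1 / X) + (X - 1) ^ (k - 2) * R (-1 / (X - 1)) = 0 := by
  intro X hX0 hX1
  have hX1' : X - 1 ≠ 0 := sub_ne_zero.mpr hX1
  obtain ⟨w, rfl⟩ := Nat.exists_eq_add_of_le' (show 2 ≤ k by lia)
  have hw : Even w := by simpa [Nat.even_add] using hkeven
  obtain ⟨A, C, hA, hC⟩ := exists_cuspForm_decay f
  have hrel := period_three_term_relation hw
    (UpperHalfPlane.mdifferentiable_iff.mp (CuspFormClass.holo f))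
    (fun z _ ↦ cuspForm_comp_ofComplex_add_one f z) (cuspForm_comp_ofComplex_inv f) hA hC X
  have hscale : ∀ c Y a b : ℂ, (∀ s : ℂ, c * (Y - s) = a * s + b) →
      c ^ w * R Y = ∫ t in Ioi (0 : ℝ), (f ∘ ofComplex) (Complex.I * t) * (a * (Complex.I * t) + b) ^ w := by
    intro c Y a b h
    rw [hR, ← integral_const_mul]
    refine setIntegral_congr_fun measurableSet_Ioi fun t ht ↦ ?_
    have him : 0 < (Complex.I * (t : ℂ)).im := by simpa using ht
    simp only [Nat.add_sub_cancel, hF t ht, Function.comp_apply, ofComplex_apply_of_im_pos him,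
      ← h, mul_pow]
    ring
  rw [← hrel, ← hscale 1 X (-1) X (fun s ↦ by ring),
    ← hscale X (1 - 1 / X) (-X) (X - 1) (fun s ↦ by field_simp; ring),
    ← hscale (X - 1) (-1 / (X - 1)) (-(X - 1)) (-1) (fun s ↦ by field_simp; ring)]
  simp
end
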